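/- arXiv:2404.14078 — 11 statements merged into one kernel-verified Lean document; each statement's English description precedes it below -/
import Mathlib

section
/- Let n ≥ 1 be odd. Then every Rota–Baxter operator on the dihedral group D_{2n} (of order 2n) is splitting. -/
/-- A Rota–Baxter operator of weight 1 on a group. -/
def IsRotaBaxter {G : Type*} [Group G] (B : G → G) : Prop :=
  ∀ g h : G, B g * B h = B (g * B g * h * (B g)⁻¹)

/-- A splitting Rota–Baxter operator: comes from an exact factorization G = HL. -/
def IsSplitting {G : Type*} [Group G] (B : G → G) : Prop :=
  ∃ H L : Subgroup G, H ⊓ L = ⊥ ∧ (∀ g : G, ∃ h ∈ H, ∃ l ∈ L, g = h * l) ∧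
    (∀ h ∈ H, ∀ l ∈ L, B (h * l) = l⁻¹)

/-- The companion Rota–Baxter operator B̃(g) = g⁻¹ · B(g⁻¹). -/
def tilde {G : Type*} [Group G] (B : G → G) : G → G := fun g => g⁻¹ * B g⁻¹

theorem IsRotaBaxter.map_one {G : Type*} [Group G] {B : G → G} (hB : IsRotaBaxter B) : B 1 = 1 := by
  simpa using hB 1 1

/-- The graph `{(g * B g, B g)}` of a Rota–Baxter operator, a subgroup of `G × G`. -/
def IsRotaBaxter.graph {G : Type*} [Group G] {B : G → G} (hB : IsRotaBaxter B) :
    Subgroup (G × G) where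
  carrier := {p | B (p.1 * p.2⁻¹) = p.2}
  one_mem' := by simpa using hB.map_one
  mul_mem' := by
    rintro ⟨a, b⟩ ⟨c, d⟩ hab hcd
    have h := hB (a * b⁻¹) (c * d⁻¹)
    simp only [Set.mem_ofPred_eq, Prod.mk_mul_mk] at *
    rw [hab, hcd] at h
    exact (congrArg B (by group)).trans h.symm
  inv_mem' := by
    rintro ⟨a, b⟩ hab
    have h := hB (a * b⁻¹) (a⁻¹ * b)
    simp only [Set.mem_ofPred_eq, Prod.inv_mk, inv_inv] at *
    rw [hab] at h
    refine eq_inv_of_mul_eq_one_right (h.trans ?_)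
    exact (congrArg B (by group)).trans hB.map_one

namespace IsRotaBaxter

variable {G : Type*} [Group G] {B : G → G} (hB : IsRotaBaxter B)

theorem mem_graph {a b : G} : (a, b) ∈ hB.graph ↔ B (a * b⁻¹) = b := Iff.rfl

theorem mul_map_mem_graph (g : G) : (g * B g, B g) ∈ hB.graph := by
  simp [mem_graph]

theorem eq_one_of_diag_mem_graph {a : G} (h : (a, a) ∈ hB.graph) : a = 1 := by
  rw [mem_graph, mul_inv_cancel, hB.map_one] at h
  exact h.symm

theorem eq_one_of_isConj_of_mem_graph {a b : G} (h : (a, b) ∈ hB.graph) (hab : IsConj b a) :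
    b = 1 := by
  obtain ⟨x, rfl⟩ := isConj_iff.1 hab
  have hx := hB.mul_map_mem_graph x
  have hc := mul_mem (mul_mem (inv_mem hx) h) hx
  have : (((B x)⁻¹ * b * B x), ((B x)⁻¹ * b * B x)) ∈ hB.graph := by
    convert hc using 1
    ext <;> simp [mul_assoc]
  simpa [mul_assoc, inv_mul_eq_one, eq_comm] using hB.eq_one_of_diag_mem_graph this

/-- A Rota–Baxter operator whose graph is a product of two subgroups is splitting. -/
theorem isSplitting_of_graph (h : ∀ a b, (a, b) ∈ hB.graph → (a, 1) ∈ hB.graph) :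
    IsSplitting B := by
  refine ⟨hB.graph.comap (MonoidHom.inl G G), hB.graph.comap (MonoidHom.inr G G), ?_, ?_, ?_⟩
  · refine (Subgroup.eq_bot_iff_forall _).2 fun a ha => ?_
    refine hB.eq_one_of_diag_mem_graph ?_
    simpa using mul_mem (Subgroup.mem_comap.1 ha.1) (Subgroup.mem_comap.1 ha.2)
  · intro g
    have hg := hB.mul_map_mem_graph g
    have h1 := h _ _ hg
    refine ⟨g * B g, h1, (B g)⁻¹, ?_, by group⟩
    have := mul_mem (inv_mem h1) hg
    simpa using this
  · intro a ha b hb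
    have := mul_mem (Subgroup.mem_comap.1 ha) (inv_mem (Subgroup.mem_comap.1 hb))
    simpa [mem_graph] using this

end IsRotaBaxter

namespace DihedralGroup

variable {n : ℕ}

theorem r_pow_self (i : ZMod n) : (r i) ^ n = 1 := by
  simp [r_pow]

theorem sr_pow_of_odd {m : ℕ} (hm : Odd m) (i : ZMod n) : (sr i) ^ m = sr i := by
  obtain ⟨k, rfl⟩ := hm
  rw [pow_succ, pow_mul, pow_two, sr_mul_self, one_pow, one_mul]

theorem isConj_sr_sr (hn : Odd n) (i j : ZMod n) : IsConj (sr i) (sr j) := by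
  obtain ⟨k, hk⟩ := hn
  have h0 : (2 * k + 1 : ZMod n) = 0 := by
    have := ZMod.natCast_self n
    rw [hk] at this ⊢
    exact_mod_cast this
  refine isConj_iff.2 ⟨r ((j - i) * k), ?_⟩
  simp only [r_mul_sr, inv_r, sr_mul_r, sr.injEq]
  linear_combination (i - j) * h0

theorem one_left_mem_of_sr_one_mem (hn : Odd n) {K : Subgroup (DihedralGroup n × DihedralGroup n)}
    (hK : ∀ i j, (sr i, sr j) ∉ K) {k : ZMod n} (hk : (sr k, 1) ∈ K) {a b : DihedralGroup n}
    (hab : (a, b) ∈ K) : (1, b) ∈ K := by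
  have rot : ∀ i j : ZMod n, (r i, r j) ∈ K → (1, r j) ∈ K := by
    intro i j h
    have h2 : (1, r j * r j) ∈ K := by
      convert mul_mem (mul_mem (mul_mem hk h) hk) h using 1
      simp [← r_zero]
    obtain ⟨m, hm⟩ := hn
    have h3 := pow_mem h2 (m + 1)
    rwa [Prod.pow_mk, one_pow, ← pow_two, ← pow_mul, show 2 * (m + 1) = n + 1 by omega, pow_succ,
      r_pow_self, one_mul] at h3
  rcases a with i | i <;> rcases b with j | j
  · exact rot i j hab
  · have := mul_mem hk hab
    simp only [Prod.mk_mul_mk, sr_mul_r, one_mul] at this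
    exact absurd this (hK _ _)
  · have := mul_mem hk hab
    simp only [Prod.mk_mul_mk, sr_mul_sr, one_mul] at this
    exact rot _ j this
  · exact absurd hab (hK _ _)

end DihedralGroup

/-- Every Rota–Baxter operator on the dihedral group D₂ₙ with n odd is splitting. -/
theorem stmt1 (n : ℕ) (hn : 1 ≤ n) (hodd : Odd n)
    (B : DihedralGroup n → DihedralGroup n) (hB : IsRotaBaxter B) :
    IsSplitting B := by
  have hK : ∀ i j, (DihedralGroup.sr i, DihedralGroup.sr j) ∉ hB.graph := fun i j h =>
    nomatch hB.eq_one_of_isConj_of_mem_graph h (DihedralGroup.isConj_sr_sr hodd j i)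
  refine hB.isSplitting_of_graph fun a b hab => ?_
  have hs := hB.mul_map_mem_graph (DihedralGroup.sr 0)
  have hp := pow_mem hs n
  rcases hx : B (DihedralGroup.sr 0) with i | i
  · rw [hx, DihedralGroup.sr_mul_r, Prod.pow_mk, DihedralGroup.sr_pow_of_odd hodd,
      DihedralGroup.r_pow_self] at hp
    have := DihedralGroup.one_left_mem_of_sr_one_mem hodd hK hp hab
    simpa using mul_mem hab (inv_mem this)
  · rw [hx, DihedralGroup.sr_mul_sr, Prod.pow_mk, DihedralGroup.sr_pow_of_odd hodd,
      DihedralGroup.r_pow_self] at hp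
    have := DihedralGroup.one_left_mem_of_sr_one_mem hodd
      (K := hB.graph.comap (MulEquiv.prodComm (M := DihedralGroup n)
        (N := DihedralGroup n)).toMonoidHom)
      (fun i j h => hK j i h) (k := i) hp (a := b) (b := a) hab
    exact this
end

section
/- Every Rota–Baxter operator on the symmetric group S_3 (equivalently, on the dihedral group D_6) is splitting. -/
theorem IsRotaBaxter.map_mul_of_map_eq_one {G : Type*} [Group G] {B : G → G}
    (hB : IsRotaBaxter B) {g : G} (hg : B g = 1) (h : G) : B (g * h) = B h := by
  have := hB g h
  simpa [hg] using this.symm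

/-- If `g * B g` always lies in the kernel of `B`, then `B` is splitting, with
`H = {g | B g = 1}` and `L = {g | B g = g⁻¹}`. -/
theorem IsRotaBaxter.isSplitting_of_map_mul_map {G : Type*} [Group G] {B : G → G}
    (hB : IsRotaBaxter B) (hP : ∀ g, B (g * B g) = 1) : IsSplitting B := by
  let H : Subgroup G :=
    { carrier := {g | B g = 1}
      one_mem' := hB.map_one
      mul_mem' := fun {a b} ha hb => (hB.map_mul_of_map_eq_one ha b).trans hb
      inv_mem' := fun {a} ha => by
        have h := hB.map_mul_of_map_eq_one ha a⁻¹
        rw [mul_inv_cancel, hB.map_one] at h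
        exact h.symm }
  let L : Subgroup G :=
    { carrier := {g | B g = g⁻¹}
      one_mem' := by simp [hB.map_one]
      mul_mem' := fun {a b} ha hb => by
        have h := hB b a
        simp only [Set.mem_ofPred_eq] at ha hb ⊢
        rw [ha, hb] at h
        simpa using h.symm
      inv_mem' := fun {a} ha => by
        have h := hB a a⁻¹
        simp only [Set.mem_ofPred_eq] at ha ⊢
        rw [ha] at h
        simp only [mul_inv_cancel, one_mul, inv_inv, inv_mul_cancel, hB.map_one] at h
        rw [inv_inv]
        exact (inv_mul_eq_one.mp h).symm }
  refine ⟨H, L, ?_, fun g => ⟨g * B g, hP g, (B g)⁻¹, ?_, by simp⟩, ?_⟩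
  · rw [Subgroup.eq_bot_iff_forall]
    rintro x ⟨hx, hx'⟩
    have h : x⁻¹ = 1 := Eq.trans (Eq.symm hx') hx
    simpa using h
  · have h := hB.map_mul_of_map_eq_one (hP g) (B g)⁻¹
    rw [mul_inv_cancel_right] at h
    change B (B g)⁻¹ = (B g)⁻¹⁻¹
    rw [inv_inv, ← h]
  · intro h hh l hl
    exact (hB.map_mul_of_map_eq_one hh l).trans hl

theorem IsRotaBaxter.map_eq_one_or_inv_of_pow_three
    {B : Equiv.Perm (Fin 3) → Equiv.Perm (Fin 3)} (hB : IsRotaBaxter B)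
    {r : Equiv.Perm (Fin 3)} (hr : r ^ 3 = 1) : B r = 1 ∨ B r = r⁻¹ := by
  have key : ∀ r b : Equiv.Perm (Fin 3), r ^ 3 = 1 →
      b = 1 ∨ b = r⁻¹ ∨ ∃ h, r * b * h * b⁻¹ = h := by decide
  obtain h | h | ⟨h, hh⟩ := key r (B r) hr
  · exact Or.inl h
  · exact Or.inr h
  · have := hB r h
    rw [hh] at this
    exact Or.inl (by simpa using this)

theorem IsRotaBaxter.map_mul_map_perm_fin_three
    {B : Equiv.Perm (Fin 3) → Equiv.Perm (Fin 3)} (hB : IsRotaBaxter B)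
    (t : Equiv.Perm (Fin 3)) : B (t * B t) = 1 := by
  have key : ∀ t b : Equiv.Perm (Fin 3), b = 1 ∨ b = t⁻¹ ∨ t ^ 3 = 1 ∨
      (b * b = 1 ∧ t * b * t * b⁻¹ = t * b * (t * b) ∧ (t * b) ^ 3 = 1) ∨
      (t * b * t * b⁻¹ = b ∧ b ^ 3 = 1) := by decide
  have hinv : ∀ t, B t = t⁻¹ → B (t * B t) = 1 := fun t h => by
    rw [h, mul_inv_cancel, hB.map_one]
  have hone : ∀ t, B t = 1 → B (t * B t) = 1 := fun t h => by rw [h, mul_one, h]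
  obtain h | h | h | ⟨hb, ht, hr⟩ | ⟨ht, hb⟩ := key t (B t)
  · exact hone t h
  · exact hinv t h
  · exact (hB.map_eq_one_or_inv_of_pow_three h).elim (hone t) (hinv t)
  · have hsq := hB t t
    rw [hb, ht] at hsq
    generalize t * B t = r at hsq hr ⊢
    obtain h | h := hB.map_eq_one_or_inv_of_pow_three hr
    · exact h
    · have h' := hB r r
      rw [h, mul_inv_cancel, one_mul, inv_inv, ← hsq] at h'
      have hr2 : r * r = 1 := by rw [← inv_inj, mul_inv_rev, h', inv_one]
      have : r = 1 := by rwa [pow_succ, pow_two, hr2, one_mul] at hr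
      rw [this, hB.map_one]
  · have hsq := hB t t
    rw [ht] at hsq
    have h := hB t (B t)
    rwa [← hsq, mul_inv_cancel_right, ← pow_two, ← pow_succ', hb, eq_comm] at h

/-- Every Rota–Baxter operator on the symmetric group S₃ is splitting. -/
theorem stmt3 (B : Equiv.Perm (Fin 3) → Equiv.Perm (Fin 3)) (hB : IsRotaBaxter B) :
    IsSplitting B :=
  hB.isSplitting_of_map_mul_map hB.map_mul_map_perm_fin_three
end

section
/- Let n ≥ 3 be odd and let B be a non-splitting Rota–Baxter operator on the generalized quaternion group Q_{4n} of order 4n. Then Im(B) ∩ Im(B̃) has exactly 2 elements. -/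
namespace IsRotaBaxter

variable {G : Type*} [Group G] {B : G → G}

theorem map_one_s4 (hB : IsRotaBaxter B) : B 1 = 1 := by
  have h := hB 1 1
  simpa using h

/-- The pairs `(g * B g, B g)` form a subgroup of `G × G`. -/
def graph_s4 (hB : IsRotaBaxter B) : Subgroup (G × G) where
  carrier := Set.range fun g => (g * B g, B g)
  one_mem' := ⟨1, by simp [hB.map_one_s4]⟩
  mul_mem' := by
    rintro _ _ ⟨g, rfl⟩ ⟨h, rfl⟩
    refine ⟨g * B g * h * (B g)⁻¹, ?_⟩
    simp only [← hB g h, Prod.mk_mul_mk, Prod.mk.injEq, and_true]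
    group
  inv_mem' := by
    rintro _ ⟨g, rfl⟩
    have h := hB g ((B g)⁻¹ * g⁻¹ * B g)
    have e : g * B g * ((B g)⁻¹ * g⁻¹ * B g) * (B g)⁻¹ = 1 := by group
    rw [e, hB.map_one_s4] at h
    refine ⟨(B g)⁻¹ * g⁻¹ * B g, ?_⟩
    simp [eq_inv_of_mul_eq_one_right h]

theorem mem_graph_self (hB : IsRotaBaxter B) (g : G) : (g * B g, B g) ∈ hB.graph_s4 :=
  ⟨g, rfl⟩

theorem mk_mem_graph_iff (hB : IsRotaBaxter B) {h l : G} :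
    (h, l) ∈ hB.graph_s4 ↔ B (h * l⁻¹) = l := by
  constructor
  · rintro ⟨g, hg⟩
    simp only [Prod.mk.injEq] at hg
    obtain ⟨rfl, rfl⟩ := hg
    simp
  · intro e
    have := hB.mem_graph_self (h * l⁻¹)
    simpa [e] using this

theorem eq_one_of_diag_mem_graph_s4 (hB : IsRotaBaxter B) {h : G} (hh : (h, h) ∈ hB.graph_s4) :
    h = 1 := by
  rw [hB.mk_mem_graph_iff, mul_inv_cancel, hB.map_one_s4] at hh
  exact hh.symm

theorem mem_range_iff (hB : IsRotaBaxter B) {l : G} :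
    l ∈ Set.range B ↔ ∃ h, (h, l) ∈ hB.graph_s4 := by
  constructor
  · rintro ⟨g, rfl⟩
    exact ⟨_, hB.mem_graph_self g⟩
  · rintro ⟨h, hh⟩
    exact ⟨_, hB.mk_mem_graph_iff.1 hh⟩

theorem mem_range_tilde_iff (hB : IsRotaBaxter B) {h : G} :
    h ∈ Set.range (tilde B) ↔ ∃ l, (h, l) ∈ hB.graph_s4 := by
  constructor
  · rintro ⟨g, rfl⟩
    exact ⟨_, hB.mem_graph_self g⁻¹⟩
  · rintro ⟨l, g, hg⟩
    simp only [Prod.mk.injEq] at hg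
    exact ⟨g⁻¹, by simp [tilde, hg.1]⟩

theorem tilde (hB : IsRotaBaxter B) : IsRotaBaxter (tilde B) := by
  intro g h
  have e := hB g⁻¹ h⁻¹
  simp only [_root_.tilde, mul_inv_rev, inv_inv, mul_assoc] at e ⊢
  simp [← e]

theorem tilde_tilde (B : G → G) : _root_.tilde (_root_.tilde B) = B := by
  ext g
  simp [_root_.tilde]

theorem isSplitting (hB : IsRotaBaxter B)
    (h : Set.range B ∩ Set.range (_root_.tilde B) ⊆ {1}) : IsSplitting B := by
  have key : ∀ x, x ∈ hB.graph_s4.map (MonoidHom.fst G G) →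
      x ∈ hB.graph_s4.map (MonoidHom.snd G G) → x = 1 := by
    rintro x ⟨⟨x₁, l⟩, hp, rfl⟩ ⟨⟨k, x₂⟩, hq, hx⟩
    simp only [MonoidHom.coe_snd, MonoidHom.coe_fst] at hx ⊢
    subst hx
    exact h ⟨hB.mem_range_iff.2 ⟨_, hq⟩, hB.mem_range_tilde_iff.2 ⟨_, hp⟩⟩
  have hH : ∀ g, g * B g ∈ hB.graph_s4.map (MonoidHom.fst G G) := fun g =>
    ⟨_, hB.mem_graph_self g, rfl⟩
  have hL : ∀ g, B g ∈ hB.graph_s4.map (MonoidHom.snd G G) := fun g =>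
    ⟨_, hB.mem_graph_self g, rfl⟩
  refine ⟨hB.graph_s4.map (MonoidHom.fst G G), hB.graph_s4.map (MonoidHom.snd G G), ?_, ?_, ?_⟩
  · rw [Subgroup.eq_bot_iff_forall]
    exact fun x hx => key x hx.1 hx.2
  · exact fun g => ⟨g * B g, hH g, (B g)⁻¹, inv_mem (hL g), by simp⟩
  · intro x hx l hl
    have e : x⁻¹ * (x * l * B (x * l)) = l * B (x * l) := by group
    have := key (l * B (x * l)) (e ▸ mul_mem (inv_mem hx) (hH _)) (mul_mem hl (hL _))
    exact eq_inv_of_mul_eq_one_right this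

end IsRotaBaxter

namespace QuaternionGroup

variable {n : ℕ}

theorem natCast_add_natCast_self : (n + n : ZMod (2 * n)) = 0 := by
  have h := ZMod.natCast_self (2 * n)
  push_cast at h
  rw [← h]
  ring

theorem a_pow (i : ZMod (2 * n)) (k : ℕ) : a i ^ k = a ((k : ZMod (2 * n)) * i) := by
  induction k with
  | zero => simp
  | succ k ih =>
    rw [pow_succ, ih, a_mul_a]
    push_cast
    ring_nf

theorem xa_mul_self (i : ZMod (2 * n)) : xa i * xa i = a (n : ZMod (2 * n)) := by
  simp

theorem natCast_mul_eq_zero_or (i : ZMod (2 * n)) :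
    (n * i : ZMod (2 * n)) = 0 ∨ (n * i : ZMod (2 * n)) = n := by
  have h := natCast_add_natCast_self (n := n)
  obtain ⟨m, rfl⟩ := ZMod.intCast_surjective i
  obtain ⟨k, rfl | rfl⟩ := Int.even_or_odd' m
  · left
    push_cast
    linear_combination (k : ZMod (2 * n)) * h
  · right
    push_cast
    linear_combination (k : ZMod (2 * n)) * h

theorem a_natCast_ne_one (hn : n ≠ 0) : a (n : ZMod (2 * n)) ≠ 1 := by
  rw [one_def, Ne, a.injEq, ZMod.natCast_eq_zero_iff]
  intro h
  have := Nat.le_of_dvd (by omega) h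
  omega

variable {B : QuaternionGroup n → QuaternionGroup n}

theorem not_xa_mem_graph (hn : n ≠ 0) (hB : IsRotaBaxter B) (i j : ZMod (2 * n)) :
    (xa i, xa j) ∉ hB.graph_s4 := by
  intro h
  have h2 := mul_mem h h
  rw [Prod.mk_mul_mk, xa_mul_self, xa_mul_self] at h2
  exact a_natCast_ne_one hn (hB.eq_one_of_diag_mem_graph_s4 h2)

theorem range_or_range_tilde_subset (hn : n ≠ 0) (hB : IsRotaBaxter B) :
    Set.range B ⊆ Set.range a ∨ Set.range (tilde B) ⊆ Set.range a := by
  by_contra! hc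
  simp only [Set.not_subset] at hc
  obtain ⟨⟨y, hy, hya⟩, ⟨y', hy', hya'⟩⟩ := hc
  obtain ⟨c, hc⟩ := hB.mem_range_iff.1 hy
  obtain ⟨d, hd⟩ := hB.mem_range_tilde_iff.1 hy'
  rcases y with i | i
  · exact hya ⟨i, rfl⟩
  rcases y' with j | j
  · exact hya' ⟨j, rfl⟩
  rcases c with c | c
  · rcases d with d | d
    · exact not_xa_mem_graph hn hB _ _ (mul_mem hc hd)
    · exact not_xa_mem_graph hn hB _ _ hd
  · exact not_xa_mem_graph hn hB _ _ hc

theorem one_a_mem_graph (hodd : Odd n) (hB : IsRotaBaxter B)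
    (hH : Set.range (tilde B) ⊆ Set.range a) {i : ZMod (2 * n)} (hi : a i ∈ Set.range B) :
    (1, a i) ∈ hB.graph_s4 := by
  have hfst : ∀ {h l}, (h, l) ∈ hB.graph_s4 → ∃ k, a k = h := fun hp =>
    hH (hB.mem_range_tilde_iff.2 ⟨_, hp⟩)
  obtain ⟨k, hn⟩ := hodd
  have hnn := natCast_add_natCast_self (n := n)
  have hncast : (n : ZMod (2 * n)) = 2 * k + 1 := by exact_mod_cast congrArg _ hn
  obtain ⟨j, c, hj⟩ : ∃ j c, (a c, xa j) ∈ hB.graph_s4 := by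
    have hx := hB.mem_graph_self (xa 0)
    obtain ⟨c, hc⟩ := hfst hx
    rcases hBx : B (xa 0) with b | b
    · rw [hBx] at hc
      simp at hc
    · exact ⟨b, c, by rw [hc, ← hBx]; exact hx⟩
  obtain ⟨x', hx'⟩ := hB.mem_range_iff.1 hi
  obtain ⟨d, rfl⟩ := hfst hx'
  have hz : (1, a (n : ZMod (2 * n))) ∈ hB.graph_s4 := by
    have h := pow_mem hj (2 * n)
    have e1 : (a c : QuaternionGroup n) ^ (2 * n) = 1 := by
      rw [a_pow, ZMod.natCast_self, zero_mul, a_zero]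
    have e2 : (xa j : QuaternionGroup n) ^ (2 * n) = a (n : ZMod (2 * n)) := by
      rw [pow_mul, pow_two, xa_mul_self, a_pow]
      congr 1
      linear_combination (n : ZMod (2 * n)) * hncast + k * hnn
    rwa [Prod.pow_mk, e1, e2] at h
  have hsq : (1, a (2 * i)) ∈ hB.graph_s4 := by
    have h := mul_mem (mul_mem hx' hj) (mul_mem (inv_mem hx') (inv_mem hj))
    have e1 : (a d * a c * ((a d)⁻¹ * (a c)⁻¹) : QuaternionGroup n) = 1 := by
      have : (a d * a c : QuaternionGroup n) = a c * a d := by simp [add_comm]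
      rw [this]
      group
    have e2 : (a i * xa j * ((a i)⁻¹ * (xa j)⁻¹) : QuaternionGroup n) = a (2 * i) := by
      rw [← mul_assoc, mul_inv_eq_iff_eq_mul, mul_inv_eq_iff_eq_mul]
      simp
      ring
    simpa only [Prod.inv_mk, Prod.mk_mul_mk, e1, e2] using h
  have hni : (1, a (n * i : ZMod (2 * n))) ∈ hB.graph_s4 := by
    rcases natCast_mul_eq_zero_or i with h | h
    · rw [h, a_zero]
      exact one_mem _
    · rwa [h]
  have h := mul_mem hni (inv_mem (pow_mem hsq k))
  have e : (a (n * i : ZMod (2 * n)) * (a (2 * i) ^ k)⁻¹ : QuaternionGroup n) = a i := by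
    rw [mul_inv_eq_iff_eq_mul, a_pow, a_mul_a]
    congr 1
    linear_combination i * hncast
  simpa only [Prod.pow_mk, Prod.inv_mk, Prod.mk_mul_mk, one_pow, inv_one, mul_one, e] using h

theorem ncard_range_inter_le (hodd : Odd n) (hB : IsRotaBaxter B)
    (hH : Set.range (tilde B) ⊆ Set.range a) :
    (Set.range B ∩ Set.range (tilde B)).ncard ≤ 2 := by
  have : NeZero n := ⟨hodd.pos.ne'⟩
  have hl : ∀ p : (Set.range B ∩ Set.range (tilde B) : Set _) × ZMod (2 * n),
      (1, B (a p.2) * p.1) ∈ hB.graph_s4 := by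
    rintro ⟨⟨x, hx, hx'⟩, i⟩
    obtain ⟨j, rfl⟩ := hH hx'
    obtain ⟨c, hc⟩ := hB.mem_range_iff.1 hx
    obtain ⟨d, hd⟩ := hH (hB.mem_range_tilde_iff.2 ⟨_, hB.mem_graph_self (a i)⟩)
    have hBi : B (a i) = a (-i + d) := by
      rw [← a_mul_a, hd, ← mul_assoc, a_mul_a, neg_add_cancel, a_zero, one_mul]
    have hm := hB.mem_range_iff.2 ⟨_, mul_mem (hB.mem_graph_self (a i)) hc⟩
    simp only at hm ⊢
    rw [hBi, a_mul_a] at hm ⊢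
    exact one_a_mem_graph hodd hB hH hm
  have ht : ∀ h, ∃ l, h ∈ Set.range (tilde B) → (h, l) ∈ hB.graph_s4 := by
    intro h
    by_cases hh : h ∈ Set.range (tilde B)
    · obtain ⟨l, hl⟩ := hB.mem_range_tilde_iff.1 hh
      exact ⟨l, fun _ => hl⟩
    · exact ⟨1, fun h => absurd h hh⟩
  choose t ht using ht
  let h (p : (Set.range B ∩ Set.range (tilde B) : Set _) × ZMod (2 * n)) :=
    a p.2 * B (a p.2) * p.1
  let l (p : (Set.range B ∩ Set.range (tilde B) : Set _) × ZMod (2 * n)) := B (a p.2) * p.1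
  have hh : ∀ p, h p ∈ Set.range (tilde B) := by
    rintro ⟨⟨x, hx, hx'⟩, i⟩
    obtain ⟨l, hl⟩ := hB.mem_range_tilde_iff.1 hx'
    exact hB.mem_range_tilde_iff.2 ⟨_, mul_mem (hB.mem_graph_self (a i)) hl⟩
  have hB' : ∀ p, B (h p * (t (h p))⁻¹ * l p) = (l p)⁻¹ * t (h p) := by
    intro p
    have hm := mul_mem (inv_mem (show (1, l p) ∈ hB.graph_s4 from hl p)) (ht _ (hh p))
    simp only [Prod.inv_mk, inv_one, Prod.mk_mul_mk, one_mul] at hm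
    simpa [mul_assoc] using hB.mk_mem_graph_iff.1 hm
  have hinj : Function.Injective fun p => h p * (t (h p))⁻¹ * l p := by
    intro p q hpq
    simp only at hpq
    have e1 := hB' p
    rw [hpq, hB' q] at e1
    have e2 : h p = h q := by
      have : h p * (t (h p))⁻¹ * l p * ((l p)⁻¹ * t (h p)) =
          h q * (t (h q))⁻¹ * l q * ((l q)⁻¹ * t (h q)) := by rw [hpq, e1]
      simpa [mul_assoc] using this
    rw [e2] at hpq
    have e3 : l p = l q := mul_left_cancel hpq
    have e4 : p.2 = q.2 := by
      simp only [h, mul_assoc] at e2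
      change a p.2 * l p = a q.2 * l q at e2
      rw [e3] at e2
      exact a.inj (mul_right_cancel e2)
    simp only [l, e4] at e3
    exact Prod.ext (Subtype.ext (mul_left_cancel e3)) e4
  have hcard := Nat.card_le_card_of_injective _ hinj
  rw [Nat.card_prod, Nat.card_zmod, Nat.card_eq_fintype_card (α := QuaternionGroup n),
    card, Nat.card_coe_set_eq] at hcard
  have := hodd.pos
  nlinarith

end QuaternionGroup

/-- For n ≥ 3 odd, any non-splitting Rota–Baxter operator B on the generalized quaternion group
Q₄ₙ satisfies |Im(B) ∩ Im(B̃)| = 2. -/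
theorem stmt4 (n : ℕ) (hn : 3 ≤ n) (hodd : Odd n)
    (B : QuaternionGroup n → QuaternionGroup n) (hB : IsRotaBaxter B)
    (hns : ¬ IsSplitting B) :
    (Set.range B ∩ Set.range (tilde B)).ncard = 2 := by
  have hn0 : NeZero n := ⟨by omega⟩
  refine le_antisymm ?_ ?_
  · rcases QuaternionGroup.range_or_range_tilde_subset (by omega) hB with h | h
    · have := QuaternionGroup.ncard_range_inter_le hodd hB.tilde
        (by rwa [IsRotaBaxter.tilde_tilde])
      rwa [IsRotaBaxter.tilde_tilde, Set.inter_comm] at this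
    · exact QuaternionGroup.ncard_range_inter_le hodd hB h
  · by_contra! hlt
    have h1 : (1 : QuaternionGroup n) ∈ Set.range B ∩ Set.range (tilde B) :=
      ⟨hB.mem_range_iff.2 ⟨1, one_mem _⟩, hB.mem_range_tilde_iff.2 ⟨1, one_mem _⟩⟩
    refine hns (hB.isSplitting fun x hx => ?_)
    exact (Set.ncard_le_one (Set.toFinite _)).1 (by omega) x hx 1 h1
end

section
/- Let G be a group with an exact factorization G = HL, and let C : L → L be a Rota–Baxter operator on the subgroup L. Suppose that for every l ∈ L, conjugation by the element C̃(l) = l⁻¹·C(l⁻¹) (viewed in G) maps H onto H. Then the map B : G → G defined by B(h·l) = C(l) for h ∈ H and l ∈ L is a Rota–Baxter operator on G. -/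
/-- Given an exact factorization G = HL and a Rota–Baxter operator C on L such that
conjugation by each C̃(l) maps H onto H, the map B(h·l) = C(l) is a Rota–Baxter
operator on G. -/
theorem stmt6 {G : Type*} [Group G] (H L : Subgroup G)
    (hmeet : H ⊓ L = ⊥) (hfact : ∀ g : G, ∃ h ∈ H, ∃ l ∈ L, g = h * l)
    (C : L → L) (hC : IsRotaBaxter C)
    (hnorm : ∀ l : L, (fun g : G => ((tilde C l : L) : G) * g * (((tilde C l : L) : G))⁻¹) '' (H : Set G)
      = (H : Set G))
    (B : G → G) (hBdef : ∀ (h : H) (l : L), B ((h : G) * (l : G)) = (C l : G)) :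
    IsRotaBaxter B := by
  intro x y
  obtain ⟨h, hh, l, hl, rfl⟩ := hfact x
  obtain ⟨k, hk, m, hm, rfl⟩ := hfact y
  lift h to H using hh
  lift l to L using hl
  lift k to H using hk
  lift m to L using hm
  have hconj : (l : G) * C l * k * ((l : G) * C l)⁻¹ ∈ H := by
    have hmem : _ ∈ (H : Set G) := hnorm l⁻¹ ▸ Set.mem_image_of_mem _ k.2
    simpa [tilde] using hmem
  have hsplit : (h : G) * l * C l * (k * m) * (C l : G)⁻¹ =
      ((h * ⟨_, hconj⟩ : H) : G) * ((l * C l * m * (C l)⁻¹ : L) : G) := by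
    push_cast
    group
  rw [hBdef, hBdef, hsplit, hBdef, ← hC]
  rfl
end

section
/- Let G be a finite group, let B be a bijective Rota–Baxter operator on G, let c be an element of the center of G, and let x ∈ G satisfy B(x) = c. Then x commutes with every element of Im(B̃), i.e. x·B̃(g) = B̃(g)·x for all g ∈ G. -/
/-- If B is a bijective Rota–Baxter operator on a finite group G, c is central and B(x) = c,
then x commutes with every element of Im(B̃). -/
theorem stmt7 {G : Type*} [Group G] [Finite G] (B : G → G) (hB : IsRotaBaxter B)
    (hbij : Function.Bijective B) (c : G) (hc : c ∈ Subgroup.center G)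
    (x : G) (hx : B x = c) :
    ∀ g : G, x * tilde B g = tilde B g * x := by
  intro g
  have hcomm : ∀ y : G, y * c = c * y := Subgroup.mem_center_iff.mp hc
  have h : B (x * B x * g⁻¹ * (B x)⁻¹) = B (g⁻¹ * B g⁻¹ * x * (B g⁻¹)⁻¹) := by
    rw [← hB, ← hB, hx, hcomm]
  have key := hbij.injective h
  rw [hx, mul_assoc x c, ← hcomm, ← mul_assoc, mul_inv_cancel_right, eq_mul_inv_iff_mul_eq,
    mul_assoc] at key
  exact key
end

section
/- Let G be a finite group, let B be a Rota–Baxter operator on G, let φ be an automorphism of G, and let x ∈ G. Then there exists a Rota–Baxter operator B' on G such that the set {(φ(B(g)), φ(x⁻¹·g·B(g)·x)) : g ∈ G} equals the set {(B'(g), g·B'(g)) : g ∈ G}. -/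
theorem IsRotaBaxter.map_conj_inv {G : Type*} [Group G] {B : G → G} (hB : IsRotaBaxter B)
    (x : G) : B ((B x)⁻¹ * x⁻¹ * B x) = (B x)⁻¹ := by
  have h := hB x ((B x)⁻¹ * x⁻¹ * B x)
  rw [show x * B x * ((B x)⁻¹ * x⁻¹ * B x) * (B x)⁻¹ = 1 by group, hB.map_one] at h
  exact eq_inv_of_mul_eq_one_right h

/-- Right translation by `x` in the group structure `g ∘ h = g * B g * h * (B g)⁻¹` induced by a
Rota–Baxter operator. -/
def IsRotaBaxter.mulRight {G : Type*} [Group G] {B : G → G} (hB : IsRotaBaxter B)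
    (x : G) : G ≃ G where
  toFun g := g * B g * x * (B g)⁻¹
  invFun g := g * B g * ((B x)⁻¹ * x⁻¹ * B x) * (B g)⁻¹
  left_inv g := by
    simp only [← hB g x]
    group
  right_inv g := by
    simp only [← hB g ((B x)⁻¹ * x⁻¹ * B x), hB.map_conj_inv x]
    group

/-- Applying (φ, φ∘conj by x) to the graph H_B of a Rota–Baxter operator B again yields the
graph of a Rota–Baxter operator. -/
theorem stmt9 {G : Type*} [Group G] [Finite G] (B : G → G) (hB : IsRotaBaxter B)
    (φ : G ≃* G) (x : G) :
    ∃ B' : G → G, IsRotaBaxter B' ∧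
      Set.range (fun g : G => (φ (B g), φ (x⁻¹ * g * B g * x)))
        = Set.range (fun g : G => (B' g, g * B' g)) := by
  let f : G ≃ G := ((hB.mulRight x).trans (Equiv.mulLeft x⁻¹)).trans φ.toEquiv
  have hf (g : G) : f g = φ (x⁻¹ * (g * B g * x * (B g)⁻¹)) := rfl
  refine ⟨fun y => φ (B (f.symm y)), ?_, ?_⟩
  · intro y z
    obtain ⟨g, rfl⟩ := f.surjective y
    obtain ⟨h, rfl⟩ := f.surjective z
    have key : f g * φ (B g) * f h * (φ (B g))⁻¹ = f (g * B g * h * (B g)⁻¹) := by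
      simp only [hf, ← hB g h, ← map_mul, ← map_inv]
      congr 1
      group
    simp only [Equiv.symm_apply_apply, key, ← map_mul, hB g h]
  · rw [← f.surjective.range_comp fun y => (φ (B (f.symm y)), y * φ (B (f.symm y)))]
    congr 1
    funext g
    simp only [Function.comp_apply, Equiv.symm_apply_apply]
    rw [hf, ← map_mul]
    congr 2
    group
end

section
/- Let G be a finite group, let B be a Rota–Baxter operator on G, let φ be an automorphism of G, and let x ∈ G. Then there exists a Rota–Baxter operator B' on G such that the set {(φ(x⁻¹·g·B(g)·x), φ(B(g))) : g ∈ G} equals the set {(B'(g), g·B'(g)) : g ∈ G}. -/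
/-- The circle product `g ↦ g * B g * x * (B g)⁻¹` attached to a Rota–Baxter operator is
right cancellative. -/
theorem IsRotaBaxter.circle_right_injective {G : Type*} [Group G] {B : G → G}
    (hB : IsRotaBaxter B) (x : G) :
    Function.Injective (fun g : G => g * B g * x * (B g)⁻¹) := by
  intro g h hgh
  have hBgh : B g = B h := by
    apply mul_right_cancel (b := B x)
    rw [hB, hB]
    exact congrArg B hgh
  simpa [hBgh] using hgh

/-- Applying the swap composed with (φ, φ∘conj by x) to the graph H_B of a Rota–Baxter operator
B again yields the graph of a Rota–Baxter operator. -/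
theorem stmt10 {G : Type*} [Group G] [Finite G] (B : G → G) (hB : IsRotaBaxter B)
    (φ : G ≃* G) (x : G) :
    ∃ B' : G → G, IsRotaBaxter B' ∧
      Set.range (fun g : G => (φ (x⁻¹ * g * B g * x), φ (B g)))
        = Set.range (fun g : G => (B' g, g * B' g)) := by
  let f : G → G := fun g => φ (B g * x⁻¹ * (g * B g)⁻¹ * x)
  have hf : Function.Injective f := by
    intro g h hgh
    apply hB.circle_right_injective x
    have key : B g * x⁻¹ * (g * B g)⁻¹ = B h * x⁻¹ * (h * B h)⁻¹ :=
      mul_right_cancel (φ.injective hgh)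
    have key' := congrArg (fun t => t⁻¹) key
    simpa [mul_assoc] using key'
  let e : G ≃ G := Equiv.ofBijective f (Finite.injective_iff_bijective.mp hf)
  let B' : G → G := fun u => φ (x⁻¹ * e.symm u * B (e.symm u) * x)
  have hB' : ∀ g, B' (f g) = φ (x⁻¹ * g * B g * x) := by
    intro g
    have he : e.symm (f g) = g := e.symm_apply_apply g
    simp only [B', he]
  have hsnd : ∀ g, f g * B' (f g) = φ (B g) := by
    intro g
    rw [hB', ← map_mul]
    congr 1
    group
  refine ⟨B', ?_, ?_⟩
  · intro u v
    obtain ⟨g, rfl⟩ := e.surjective u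
    obtain ⟨h, rfl⟩ := e.surjective v
    change B' (f g) * B' (f h) = B' (f g * B' (f g) * f h * (B' (f g))⁻¹)
    have hcirc : f g * B' (f g) * f h * (B' (f g))⁻¹ = f (g * B g * h * (B g)⁻¹) := by
      rw [hsnd, hB']
      simp only [f, ← hB g h, ← map_mul, ← map_inv]
      congr 1
      group
    rw [hcirc, hB', hB', hB', ← hB g h, ← map_mul]
    congr 1
    group
  · rw [← e.surjective.range_comp (fun g : G => (B' g, g * B' g))]
    congr 1
    funext g
    exact (Prod.ext (hB' g) (hsnd g)).symm
end

section
/- Let B be a Rota–Baxter operator on a group G and define κ : G → G × G by κ(g) = (B(g), g·B(g)). Then κ(g·B(g)·h·B(g)⁻¹) = κ(g)·κ(h) for all g, h ∈ G, and κ is injective; consequently the group (G, ∘), where g∘h = g·B(g)·h·B(g)⁻¹, is isomorphic to the subgroup H_B of G × G. -/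
/-- The map κ(g) = (B(g), g·B(g)) intertwines the derived product g∘h = g·B(g)·h·B(g)⁻¹ with the
product of G × G and is injective; hence (G, ∘) ≅ H_B ≤ G × G. -/
theorem stmt11 {G : Type*} [Group G] (B : G → G) (hB : IsRotaBaxter B) :
    (∀ g h : G,
      (B (g * B g * h * (B g)⁻¹), (g * B g * h * (B g)⁻¹) * B (g * B g * h * (B g)⁻¹))
        = (B g, g * B g) * (B h, h * B h)) ∧
    Function.Injective (fun g : G => (B g, g * B g)) := by
  refine ⟨fun g h => ?_, fun g h hgh => ?_⟩
  · rw [← hB g h, Prod.mk_mul_mk]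
    congr 1
    group
  · obtain ⟨h₁, h₂⟩ := Prod.mk.inj hgh
    rw [h₁] at h₂
    exact mul_right_cancel h₂
end

section
/- There exist a Rota–Baxter operator B on the dihedral group D_{16} (of order 16) and an element g ∈ D_{16} such that B(B̃(g)) ≠ B̃(B(g)); that is, the operators B∘B̃ and B̃∘B do not coincide in general. -/
/-- A map `DihedralGroup 8 → DihedralGroup 8` onto the Klein four-group `{1, sr 1, r 4, sr 5}`; its
value at `r i` and at `sr i` depends only on `i` modulo `4`. -/
def kleinFourOperator : DihedralGroup 8 → DihedralGroup 8
  | .r i => ![.r 0, .sr 1, .r 4, .sr 5] (Fin.ofNat 4 i.val)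
  | .sr i => ![.r 0, .sr 1, .r 4, .sr 5] (Fin.ofNat 4 i.val)

theorem isRotaBaxter_kleinFourOperator : IsRotaBaxter kleinFourOperator := by
  unfold IsRotaBaxter
  rintro (i | i) (j | j) <;> revert i j <;> decide

/-- There are a Rota–Baxter operator B on D₁₆ and g ∈ D₁₆ with B(B̃(g)) ≠ B̃(B(g)). -/
theorem stmt17 :
    ∃ B : DihedralGroup 8 → DihedralGroup 8, IsRotaBaxter B ∧
      ∃ g : DihedralGroup 8, B (tilde B g) ≠ tilde B (B g) := by
  exact ⟨kleinFourOperator, isRotaBaxter_kleinFourOperator, .r 1, by decide⟩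
end

section
/- Let n ≥ 2 be even. The map C : D_{2n} → D_{2n} defined by C(r^a) = e for a even, C(r^a) = r^{n/2}·s for a odd, C(r^a·s) = r^{n/2} for a even, and C(r^a·s) = s for a odd, is a non-splitting Rota–Baxter operator on the dihedral group D_{2n}; moreover C is a group homomorphism of D_{2n} onto the subgroup {e, r^{n/2}, s, r^{n/2}·s}. -/
theorem ZMod.even_val_add {n : ℕ} [NeZero n] (hn : Even n) (a b : ZMod n) :
    Even (a + b).val ↔ (Even a.val ↔ Even b.val) := by
  rw [ZMod.val_add, ← Nat.even_add, Nat.even_iff, Nat.even_iff,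
    Nat.mod_mod_of_dvd _ (even_iff_two_dvd.mp hn)]

theorem ZMod.even_val_neg {n : ℕ} [NeZero n] (hn : Even n) (a : ZMod n) :
    Even (-a).val ↔ Even a.val := by
  have h := ZMod.even_val_add hn (-a) a
  simpa using h

theorem ZMod.even_val_sub {n : ℕ} [NeZero n] (hn : Even n) (a b : ZMod n) :
    Even (a - b).val ↔ (Even a.val ↔ Even b.val) := by
  rw [sub_eq_add_neg, ZMod.even_val_add hn, ZMod.even_val_neg hn]

/-- A homomorphism with commutative image is a Rota–Baxter operator. -/
theorem IsRotaBaxter.of_map_mul {G : Type*} [Group G] {B : G → G}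
    (hB : ∀ x y, B (x * y) = B x * B y) (hcomm : ∀ x y, Commute (B x) (B y)) :
    IsRotaBaxter B := by
  intro g h
  have hinv : B (B g)⁻¹ = (B (B g))⁻¹ := map_inv (MonoidHom.mk' B hB) _
  rw [hB, hB, hB, hinv, mul_assoc (B g), (hcomm (B g) h).eq]
  group

/-- For even n, the map C on D₂ₙ with C(rᵃ) = e (a even), C(rᵃ) = r^{n/2}·s (a odd),
C(rᵃ·s) = r^{n/2} (a even), C(rᵃ·s) = s (a odd) is a non-splitting Rota–Baxter operator;
moreover C is a homomorphism onto {e, r^{n/2}, s, r^{n/2}·s}. -/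
theorem stmt18 (n : ℕ) (hn : 2 ≤ n) (heven : Even n)
    (C : DihedralGroup n → DihedralGroup n)
    (h1 : ∀ a : ZMod n, Even a.val → C (DihedralGroup.r a) = 1)
    (h2 : ∀ a : ZMod n, ¬ Even a.val →
      C (DihedralGroup.r a) = DihedralGroup.r (n / 2 : ℕ) * DihedralGroup.sr 0)
    (h3 : ∀ a : ZMod n, Even a.val →
      C (DihedralGroup.r a * DihedralGroup.sr 0) = DihedralGroup.r (n / 2 : ℕ))
    (h4 : ∀ a : ZMod n, ¬ Even a.val →
      C (DihedralGroup.r a * DihedralGroup.sr 0) = DihedralGroup.sr 0) :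
    IsRotaBaxter C ∧ ¬ IsSplitting C ∧
    (∀ x y : DihedralGroup n, C (x * y) = C x * C y) ∧
    Set.range C = {1, DihedralGroup.r (n / 2 : ℕ), DihedralGroup.sr 0,
      DihedralGroup.r (n / 2 : ℕ) * DihedralGroup.sr 0} := by
  have : NeZero n := ⟨by omega⟩
  set z := ((n / 2 : ℕ) : ZMod n) with hz
  have hzz : z + z = 0 := by
    rw [hz, ← Nat.cast_add, ← two_mul, Nat.two_mul_div_two_of_even heven, ZMod.natCast_self]
  have hneg : -z = z := neg_eq_of_add_eq_zero_left hzz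
  have hz0 : z ≠ 0 := by
    rw [hz, Ne, ZMod.natCast_eq_zero_iff]
    exact fun h => absurd (Nat.le_of_dvd (by omega) h) (by omega)
  have hr : ∀ a : ZMod n, ¬ Even a.val → C (.r a) = .sr z := fun a ha => by
    rw [h2 a ha, DihedralGroup.r_mul_sr, zero_sub, hneg]
  have hsr : ∀ a : ZMod n, Even a.val → C (.sr a) = .r z := fun a ha => by
    simpa using h3 (-a) ((ZMod.even_val_neg heven a).mpr ha)
  have hsr' : ∀ a : ZMod n, ¬ Even a.val → C (.sr a) = .sr 0 := fun a ha => by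
    simpa using h4 (-a) (mt (ZMod.even_val_neg heven a).mp ha)
  have hC : ∀ x, C x = 1 ∨ C x = .r z ∨ C x = .sr 0 ∨ C x = .sr z := by
    rintro (a | a) <;> by_cases ha : Even a.val <;> simp [h1, hr, hsr, hsr', ha]
  have hmul : ∀ x y, C (x * y) = C x * C y := by
    rintro (a | a) (b | b) <;> by_cases ha : Even a.val <;> by_cases hb : Even b.val <;>
      simp [hr, h1, hsr, hsr', ZMod.even_val_add heven, ZMod.even_val_sub heven, ha, hb,
        hneg, hzz, -DihedralGroup.r_zero, DihedralGroup.one_def]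
  have hcomm : ∀ x y, Commute (C x) (C y) := by
    intro x y
    rcases hC x with h | h | h | h <;> rcases hC y with h' | h' | h' | h' <;>
      simp [Commute, SemiconjBy, h, h', hneg, hzz]
  refine ⟨.of_map_mul hmul hcomm, ?_, hmul, ?_⟩
  · rintro ⟨H, L, -, hHL, hB⟩
    obtain ⟨h, hh, l, hl, e⟩ := hHL (.sr 0)
    have hCs : C (.sr 0) = .r z := hsr 0 (by simp)
    have hCh : C h = 1 := by simpa using hB h hh 1 L.one_mem
    have hCl : C l = l⁻¹ := by simpa using hB 1 H.one_mem l hl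
    have hl' : l⁻¹ = .r z := by rw [← hCs, e, hB h hh l hl]
    have hlz : l = .r z := by rw [← inv_inv l, hl', DihedralGroup.inv_r, hneg]
    rw [hl', hlz] at hCl
    by_cases hp : Even z.val
    · rw [h1 z hp, DihedralGroup.one_def, DihedralGroup.r.injEq] at hCl
      exact hz0 hCl.symm
    · rw [hr z hp] at hCl
      cases hCl
  · rw [DihedralGroup.r_mul_sr, zero_sub, hneg]
    have hv : ¬ Even (1 : ZMod n).val := by
      rw [ZMod.val_one'' (by omega)]
      exact Nat.not_even_one
    ext x
    simp only [Set.mem_range, Set.mem_insert_iff, Set.mem_singleton_iff]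
    constructor
    · rintro ⟨y, rfl⟩
      exact hC y
    · rintro (rfl | rfl | rfl | rfl)
      · exact ⟨.r 0, h1 0 (by simp)⟩
      · exact ⟨.sr 0, hsr 0 (by simp)⟩
      · exact ⟨.sr 1, hsr' 1 hv⟩
      · exact ⟨.r 1, hr 1 hv⟩
end

section
/- There exists a non-splitting Rota–Baxter operator B on the generalized quaternion group Q_{60} of order 60 such that Im(B) ∩ Im(B̃) has exactly 2 elements. -/
/-- The range of a splitting operator meets the range of its companion trivially. -/
theorem IsSplitting.eq_one_of_mem_range {G : Type*} [Group G] {B : G → G} (hB : IsSplitting B)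
    {z : G} (hz : z ∈ Set.range B) (hz' : z ∈ Set.range (tilde B)) : z = 1 := by
  obtain ⟨H, L, hHL, hfac, hval⟩ := hB
  obtain ⟨g, rfl⟩ := hz
  obtain ⟨g', hg'⟩ := hz'
  obtain ⟨h, hh, l, hl, rfl⟩ := hfac g
  obtain ⟨h', hh', l', hl', hfac'⟩ := hfac g'⁻¹
  rw [tilde, hfac', hval h' hh' l' hl', mul_inv_cancel_right] at hg'
  rw [← Subgroup.mem_bot, ← hHL]
  refine ⟨?_, ?_⟩
  · rw [← hg']
    exact hh'
  · rw [hval h hh l hl]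
    exact L.inv_mem hl

/-- The Rota–Baxter operator on `QuaternionGroup 15` sending `x * y⁻¹` to `y`, for `x = r ^ i` and
`y = s ^ j` with `i` and `j` of the same parity. -/
def parityOperator : QuaternionGroup 15 → QuaternionGroup 15
  | .a i => if Even i.val then .a 0 else .a 15
  | .xa i => if Even i.val then .xa 0 else .xa 15

theorem isRotaBaxter_parityOperator : IsRotaBaxter parityOperator := by
  unfold IsRotaBaxter
  decide +kernel

theorem range_parityOperator_inter_range_tilde :
    Set.range parityOperator ∩ Set.range (tilde parityOperator) =
      {QuaternionGroup.a 0, QuaternionGroup.a 15} := by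
  have h : ∀ g : QuaternionGroup 15, ((∃ x, parityOperator x = g) ∧
      ∃ x, x⁻¹ * parityOperator x⁻¹ = g) ↔ g = .a 0 ∨ g = .a 15 := by
    decide +kernel
  exact Set.ext h

/-- There is a non-splitting Rota–Baxter operator B on the generalized quaternion group Q₆₀
with |Im(B) ∩ Im(B̃)| = 2. -/
theorem stmt19 :
    ∃ B : QuaternionGroup 15 → QuaternionGroup 15, IsRotaBaxter B ∧
      ¬ IsSplitting B ∧ (Set.range B ∩ Set.range (tilde B)).ncard = 2 := by
  refine ⟨parityOperator, isRotaBaxter_parityOperator, fun hs => ?_, ?_⟩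
  · have hz : QuaternionGroup.a 15 ∈
        Set.range parityOperator ∩ Set.range (tilde parityOperator) := by
      simp [range_parityOperator_inter_range_tilde]
    exact absurd (hs.eq_one_of_mem_range hz.1 hz.2) (by decide)
  · rw [range_parityOperator_inter_range_tilde]
    exact Set.ncard_pair (by decide)
end
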